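/- arXiv:2507.19086 — 3 statements merged into one kernel-verified Lean document; each statement's English description precedes it below -/
import Mathlib

section
/- Let p be a prime, n ≥ 1, and let G be a compact subgroup of GL_n(ℚ_p), equipped with its normalized Haar probability measure μ. Let r ≥ 1 and let w be a nontrivial element of the free group F_r on r generators. If the set X(G,w) = {(g_1,…,g_r) ∈ G^r : w(g_1,…,g_r) = 1} has positive measure with respect to the r-fold product measure μ^{⊗r}, then w is an open coset identity on G: there exist an open subgroup H of G and elements g_1,…,g_r ∈ G such that w(g_1h_1,…,g_rh_r) = 1 for all h_1,…,h_r ∈ H. -/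
open MeasureTheory
open scoped Pointwise

theorem exists_open_subgroup_coset_subset {Γ : Type*} [Group Γ] [TopologicalSpace Γ]
    [IsTopologicalGroup Γ] [MeasurableSpace Γ] [BorelSpace Γ] (ν : Measure Γ) [IsFiniteMeasure ν]
    [ν.IsMulLeftInvariant] {F : Set (Set Γ)} (hwf : F.WellFoundedOn (· < ·))
    (hclosed : ∀ Z ∈ F, IsClosed Z) (hinter : ∀ Z ∈ F, ∀ Z' ∈ F, Z ∩ Z' ∈ F)
    (hsmul : ∀ Z ∈ F, ∀ γ : Γ, γ • Z ∈ F) {E : Set Γ} (hE : E ∈ F) (hpos : 0 < ν E) :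
    ∃ S : Subgroup Γ, IsOpen (S : Set Γ) ∧ ∃ γ : Γ, ∀ s ∈ S, s * γ ∈ E := by
  have hwf' : {Z ∈ F | Z ⊆ E ∧ 0 < ν Z}.WellFoundedOn (· < ·) := hwf.subset fun Z hZ => hZ.1
  obtain ⟨Z, ⟨hZF, hZE, hZpos⟩, hmin⟩ := hwf'.exists_minimal ⟨E, hE, subset_rfl, hpos⟩
  have hZc := hclosed Z hZF
  have hsub : ∀ γ : Γ, 0 < ν (Z ∩ γ • Z) → Z ⊆ γ • Z := fun γ h =>
    (hmin ⟨hinter _ hZF _ (hsmul _ hZF γ), Set.inter_subset_left.trans hZE, h⟩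
      Set.inter_subset_left).trans Set.inter_subset_right
  have heq : ∀ γ : Γ, 0 < ν (Z ∩ γ • Z) → γ • Z = Z := fun γ h => by
    refine (hsub γ h).antisymm' ?_
    rw [Set.smul_set_subset_iff_subset_inv_smul_set]
    apply hsub
    rw [← measure_smul ν γ, Set.smul_set_inter, smul_inv_smul, Set.inter_comm]
    exact h
  have hfin : Finite (MulAction.orbit Γ Z) := by
    have hmeas : ∀ i : MulAction.orbit Γ Z, ν (i : Set Γ) = ν Z := by
      rintro ⟨_, γ, rfl⟩
      exact measure_smul ν γ Z
    have hset := Measure.finite_const_le_meas_of_disjoint_iUnion₀ ν hZpos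
      (As := fun i : MulAction.orbit Γ Z => (i : Set Γ)) ?_ ?_ (measure_ne_top ν _)
    · simpa [hmeas, Set.finite_univ_iff] using hset
    · rintro ⟨_, γ, rfl⟩
      exact (hZc.smul γ).measurableSet.nullMeasurableSet
    · rintro ⟨_, γ, rfl⟩ ⟨_, δ, rfl⟩ hne
      by_contra hpos'
      refine hne (Subtype.ext ?_)
      have h : 0 < ν (Z ∩ (γ⁻¹ * δ) • Z) := by
        rw [← measure_smul ν γ, Set.smul_set_inter, smul_smul, mul_inv_cancel_left]
        exact pos_iff_ne_zero.2 hpos'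
      have := heq _ h
      rw [mul_smul, inv_smul_eq_iff] at this
      exact this.symm
  have : Finite (Γ ⧸ MulAction.stabilizer Γ Z) :=
    Finite.of_equiv _ (MulAction.orbitEquivQuotientStabilizer Γ Z)
  have := Subgroup.finiteIndex_of_finite_quotient (H := MulAction.stabilizer Γ Z)
  refine ⟨MulAction.stabilizer Γ Z, Subgroup.isOpen_of_isClosed_of_finiteIndex _ ?_, ?_⟩
  · have : (MulAction.stabilizer Γ Z : Set Γ) =
        ⋂ z ∈ Z, {γ | γ * z ∈ Z} ∩ {γ | γ⁻¹ * z ∈ Z} := by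
      ext γ
      simp only [SetLike.mem_coe, MulAction.mem_stabilizer_iff, Set.mem_iInter, Set.mem_inter_iff,
        Set.mem_ofPred_eq]
      refine ⟨fun h z hz => ⟨?_, ?_⟩, fun h => Set.Subset.antisymm ?_ fun z hz => ?_⟩
      · exact h ▸ Set.smul_mem_smul_set hz
      · rw [← h] at hz
        exact Set.mem_smul_set_iff_inv_smul_mem.1 hz
      · rintro _ ⟨z, hz, rfl⟩
        exact (h z hz).1
      · exact Set.mem_smul_set_iff_inv_smul_mem.2 (h z hz).2
    rw [this]
    exact isClosed_biInter fun z _ =>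
      (hZc.preimage (continuous_mul_const z)).inter
        (hZc.preimage (continuous_inv.mul continuous_const))
  · obtain ⟨γ, hγ⟩ := nonempty_of_measure_ne_zero hZpos.ne'
    refine ⟨γ, fun s hs => hZE ?_⟩
    rw [← MulAction.mem_stabilizer_iff.1 hs]
    exact Set.smul_mem_smul_set hγ

/-- The common zero loci of subsets of an algebra of functions. -/
def zeroLoci {K X : Type*} [CommRing K] (A : Subalgebra K (X → K)) : Set (Set X) :=
  {Z | ∃ T : Set (X → K), T ⊆ A ∧ Z = {x | ∀ f ∈ T, f x = 0}}

theorem wellFoundedOn_zeroLoci {K X : Type*} [CommRing K] (A : Subalgebra K (X → K))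
    [IsNoetherianRing A] : (zeroLoci A).WellFoundedOn (· < ·) := by
  let I : Set X → Ideal A := fun Z =>
    { carrier := {f | ∀ x ∈ Z, (f : X → K) x = 0}
      add_mem' := fun hf hg x hx => by simp [hf x hx, hg x hx]
      zero_mem' := fun x _ => rfl
      smul_mem' := fun c f hf x hx => by simp [hf x hx] }
  refine Subrelation.wf (r := InvImage (· > ·) fun Z => I Z.1) ?_ (InvImage.wf _ wellFounded_gt)
  rintro ⟨Z, T, hT, rfl⟩ ⟨Z', T', hT', rfl⟩ hlt
  refine lt_of_le_not_ge (fun f hf x hx => hf x (hlt.le hx)) fun hle => hlt.not_ge ?_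
  intro x hx f hf
  exact hle (x := ⟨f, hT hf⟩) (fun y hy => hy f hf) x hx

theorem inter_mem_zeroLoci {K X : Type*} [CommRing K] {A : Subalgebra K (X → K)} {Z Z' : Set X}
    (hZ : Z ∈ zeroLoci A) (hZ' : Z' ∈ zeroLoci A) : Z ∩ Z' ∈ zeroLoci A := by
  obtain ⟨T, hT, rfl⟩ := hZ
  obtain ⟨T', hT', rfl⟩ := hZ'
  refine ⟨T ∪ T', Set.union_subset hT hT', ?_⟩
  ext x
  simp [or_imp, forall_and]

instance Units.secondCountableTopology {M : Type*} [Monoid M] [TopologicalSpace M]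
    [SecondCountableTopology M] : SecondCountableTopology Mˣ :=
  have : SecondCountableTopology Mᵐᵒᵖ := MulOpposite.opHomeomorph.symm.secondCountableTopology
  Units.isEmbedding_embedProduct.secondCountableTopology

section CoordinateAlgebra

variable {K : Type*} [Field K] {r n : ℕ} (G : Subgroup (GL (Fin n) K))

/-- The algebra of functions on `G ^ r` generated by the matrix entries of the coordinates and
of their inverses. -/
def coordinateAlgebra (r : ℕ) : Subalgebra K ((Fin r → G) → K) :=
  Algebra.adjoin K
    (Set.range (fun t : Fin r × Fin n × Fin n => fun γ : Fin r → G =>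
        (γ t.1 : GL (Fin n) K).1 t.2.1 t.2.2) ∪
      Set.range (fun t : Fin r × Fin n × Fin n => fun γ : Fin r → G =>
        ((γ t.1)⁻¹ : GL (Fin n) K).1 t.2.1 t.2.2))

variable {G}

theorem entry_mem_coordinateAlgebra (i : Fin r) (j k : Fin n) :
    (fun γ : Fin r → G => (γ i : GL (Fin n) K).1 j k) ∈ coordinateAlgebra G r :=
  Algebra.subset_adjoin (Or.inl ⟨(i, j, k), rfl⟩)

theorem inv_entry_mem_coordinateAlgebra (i : Fin r) (j k : Fin n) :
    (fun γ : Fin r → G => ((γ i)⁻¹ : GL (Fin n) K).1 j k) ∈ coordinateAlgebra G r :=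
  Algebra.subset_adjoin (Or.inr ⟨(i, j, k), rfl⟩)

instance : IsNoetherianRing (coordinateAlgebra G r) :=
  isNoetherianRing_of_fg (Subalgebra.fg_def.2
    ⟨_, (Set.finite_range _).union (Set.finite_range _), rfl⟩)

theorem comp_mul_left_mem_coordinateAlgebra (δ : Fin r → G) {f : (Fin r → G) → K}
    (hf : f ∈ coordinateAlgebra G r) : (fun γ => f (δ * γ)) ∈ coordinateAlgebra G r := by
  induction hf using Algebra.adjoin_induction with
  | mem f hf =>
    rcases hf with ⟨⟨i, j, k⟩, rfl⟩ | ⟨⟨i, j, k⟩, rfl⟩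
    · have : (fun γ : Fin r → G => ((δ * γ) i : GL (Fin n) K).1 j k) =
          ∑ l, (δ i : GL (Fin n) K).1 j l • fun γ : Fin r → G => (γ i : GL (Fin n) K).1 l k := by
        ext γ
        simp [Matrix.mul_apply]
      simp only [this]
      exact sum_mem fun l _ => Subalgebra.smul_mem _ (entry_mem_coordinateAlgebra i l k) _
    · have : (fun γ : Fin r → G => (((δ * γ) i)⁻¹ : GL (Fin n) K).1 j k) =
          ∑ l, ((δ i)⁻¹ : GL (Fin n) K).1 l k •
            fun γ : Fin r → G => ((γ i)⁻¹ : GL (Fin n) K).1 j l := by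
        ext γ
        simp only [Pi.mul_apply, Subgroup.coe_mul, mul_inv_rev, Units.val_mul, Matrix.mul_apply,
          Finset.sum_apply, Pi.smul_apply, smul_eq_mul]
        exact Finset.sum_congr rfl fun _ _ => mul_comm _ _
      simp only [this]
      exact sum_mem fun l _ => Subalgebra.smul_mem _ (inv_entry_mem_coordinateAlgebra i j l) _
  | algebraMap c => exact Subalgebra.algebraMap_mem _ c
  | add f g _ _ hf hg => exact add_mem hf hg
  | mul f g _ _ hf hg => exact mul_mem hf hg

theorem lift_entry_mem_coordinateAlgebra (w : FreeGroup (Fin r)) (j k : Fin n) :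
    (fun γ : Fin r → G => (FreeGroup.lift γ w : GL (Fin n) K).1 j k) ∈
      coordinateAlgebra G r := by
  induction w using FreeGroup.induction_on generalizing j k with
  | C1 =>
    simp only [map_one]
    exact Subalgebra.algebraMap_mem _ ((1 : Matrix (Fin n) (Fin n) K) j k)
  | of i => simpa using entry_mem_coordinateAlgebra i j k
  | inv_of i _ => simpa using inv_entry_mem_coordinateAlgebra i j k
  | mul v w hv hw =>
    have : (fun γ : Fin r → G => (FreeGroup.lift γ (v * w) : GL (Fin n) K).1 j k) =
        ∑ l, (fun γ : Fin r → G => (FreeGroup.lift γ v : GL (Fin n) K).1 j l) *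
          fun γ : Fin r → G => (FreeGroup.lift γ w : GL (Fin n) K).1 l k := by
      ext γ
      simp [Matrix.mul_apply]
    rw [this]
    exact sum_mem fun l _ => mul_mem (hv j l) (hw l k)

theorem continuous_of_mem_coordinateAlgebra [TopologicalSpace K] [IsTopologicalRing K]
    {f : (Fin r → G) → K} (hf : f ∈ coordinateAlgebra G r) : Continuous f := by
  induction hf using Algebra.adjoin_induction with
  | mem f hf =>
    rcases hf with ⟨⟨i, j, k⟩, rfl⟩ | ⟨⟨i, j, k⟩, rfl⟩
    · exact (Units.continuous_val.comp
        (continuous_subtype_val.comp (continuous_apply i))).matrix_elem j k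
    · exact (Units.continuous_val.comp
        (continuous_subtype_val.comp (continuous_apply i)).inv).matrix_elem j k
  | algebraMap c => exact continuous_const
  | add f g _ _ hf hg => exact hf.add hg
  | mul f g _ _ hf hg => exact hf.mul hg

theorem isClosed_of_mem_zeroLoci_coordinateAlgebra [TopologicalSpace K] [IsTopologicalRing K]
    [T1Space K] {Z : Set (Fin r → G)} (hZ : Z ∈ zeroLoci (coordinateAlgebra G r)) :
    IsClosed Z := by
  obtain ⟨T, hT, rfl⟩ := hZ
  have : {x | ∀ f ∈ T, f x = 0} = ⋂ f ∈ T, f ⁻¹' {0} := by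
    ext x
    simp
  rw [this]
  exact isClosed_biInter fun f hf =>
    isClosed_singleton.preimage (continuous_of_mem_coordinateAlgebra (hT hf))

theorem smul_mem_zeroLoci_coordinateAlgebra (γ : Fin r → G) {Z : Set (Fin r → G)}
    (hZ : Z ∈ zeroLoci (coordinateAlgebra G r)) : γ • Z ∈ zeroLoci (coordinateAlgebra G r) := by
  obtain ⟨T, hT, rfl⟩ := hZ
  refine ⟨(fun f x => f (γ⁻¹ * x)) '' T, ?_, ?_⟩
  · rintro _ ⟨f, hf, rfl⟩
    exact comp_mul_left_mem_coordinateAlgebra γ⁻¹ (hT hf)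
  · ext x
    simp [Set.mem_smul_set_iff_inv_smul_mem]

theorem lift_eq_one_mem_zeroLoci (w : FreeGroup (Fin r)) :
    {γ : Fin r → G | FreeGroup.lift γ w = 1} ∈ zeroLoci (coordinateAlgebra G r) := by
  refine ⟨Set.range fun (jk : Fin n × Fin n) (γ : Fin r → G) =>
    (FreeGroup.lift γ w : GL (Fin n) K).1 jk.1 jk.2 -
      (1 : Matrix (Fin n) (Fin n) K) jk.1 jk.2, ?_, ?_⟩
  · rintro _ ⟨⟨j, k⟩, rfl⟩
    exact sub_mem (lift_entry_mem_coordinateAlgebra w j k) (Subalgebra.algebraMap_mem _ _)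
  · ext γ
    simp only [Set.mem_ofPred_eq, Set.forall_mem_range, Prod.forall, sub_eq_zero]
    rw [← Subtype.coe_inj, Units.ext_iff, ← Matrix.ext_iff]
    rfl

end CoordinateAlgebra

theorem exists_open_subgroup_pi_subset {ι G : Type*} [Finite ι] [Group G] [TopologicalSpace G]
    [IsTopologicalGroup G] {S : Subgroup (ι → G)} (hS : IsOpen (S : Set (ι → G))) :
    ∃ H : Subgroup G, IsOpen (H : Set G) ∧ ∀ h : ι → G, (∀ i, h i ∈ H) → h ∈ S := by
  classical
  refine ⟨⨅ i, S.comap (MonoidHom.mulSingle (fun _ => G) i), ?_, fun h hh => ?_⟩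
  · rw [Subgroup.coe_iInf]
    exact isOpen_iInter_of_finite fun i => hS.preimage (continuous_mulSingle i)
  · exact Subgroup.pi_mem_of_mulSingle_mem h fun i => (Subgroup.mem_iInf.1 (hh i)) i

/-- Let `G` be a compact subgroup of `GL_n(ℚ_p)` with its normalized Haar
probability measure `μ`. If a nontrivial word `w` in the free group on `r` generators has
positive probability of being satisfied (i.e. the solution set `X(G,w) ⊆ G^r` has positive
measure for the product measure), then `w` is an open coset identity on `G`. -/
theorem probabilistic_identity_is_open_coset_identity_GL
    {p : ℕ} [Fact p.Prime] {n : ℕ} (hn : 1 ≤ n)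
    (G : Subgroup (GL (Fin n) ℚ_[p])) (hG : IsCompact (G : Set (GL (Fin n) ℚ_[p])))
    [MeasurableSpace G] [BorelSpace G]
    (μ : Measure G) [μ.IsHaarMeasure] [IsProbabilityMeasure μ]
    {r : ℕ} (hr : 1 ≤ r) (w : FreeGroup (Fin r)) (hw : w ≠ 1)
    (hpos : 0 < Measure.pi (fun _ : Fin r => μ)
      {g : Fin r → G | FreeGroup.lift g w = 1}) :
    ∃ H : Subgroup G, IsOpen (H : Set G) ∧ ∃ g : Fin r → G,
      ∀ h : Fin r → G, (∀ i, h i ∈ H) →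
        FreeGroup.lift (fun i => g i * h i) w = 1 := by
  have : SecondCountableTopology (Matrix (Fin n) (Fin n) ℚ_[p]) :=
    inferInstanceAs (SecondCountableTopology (Fin n → Fin n → ℚ_[p]))
  have : SecondCountableTopology (GL (Fin n) ℚ_[p]) := Units.secondCountableTopology
  have : SecondCountableTopology G := TopologicalSpace.Subtype.secondCountableTopology _
  obtain ⟨S, hS, γ, hγ⟩ := exists_open_subgroup_coset_subset (Measure.pi fun _ : Fin r => μ)
    (wellFoundedOn_zeroLoci (coordinateAlgebra G r))
    (fun _ hZ => isClosed_of_mem_zeroLoci_coordinateAlgebra hZ)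
    (fun _ hZ _ hZ' => inter_mem_zeroLoci hZ hZ')
    (fun _ hZ γ => smul_mem_zeroLoci_coordinateAlgebra γ hZ) (lift_eq_one_mem_zeroLoci w) hpos
  obtain ⟨H, hH, hHS⟩ := exists_open_subgroup_pi_subset
    (S := S.comap (MulAut.conj γ).toMonoidHom)
    (hS.preimage ((continuous_const_mul γ).mul_const γ⁻¹))
  refine ⟨H, hH, γ, fun h hh => ?_⟩
  change FreeGroup.lift (γ * h) w = 1
  simpa using hγ _ (hHS h hh)
end

section
/- Let p be a prime and m, n ≥ 1. Let U be an open subset of the space ℚ_p^m = (Fin m → ℚ_p), let f : ℚ_p^m → ℚ_p^n be analytic on U (analytic in the sense of convergent power series over the complete nonarchimedean normed field ℚ_p), and let y ∈ ℚ_p^n. Let S = {x ∈ U : f(x) = y}. Then either S has nonempty interior, or S is a null set with respect to an additive Haar measure on ℚ_p^m. -/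
open MeasureTheory

open Filter Topology

/-- If the sum of a power series vanishes near the centre along a line, then it vanishes at every
point of that line given by a direction vector inside the ball of convergence. -/
theorem HasFPowerSeriesOnBall.eq_zero_of_eventually_eq_zero_on_line
    {𝕜 E F : Type*} [NontriviallyNormedField 𝕜]
    [NormedAddCommGroup E] [NormedSpace 𝕜 E] [NormedAddCommGroup F] [NormedSpace 𝕜 F]
    {f : E → F} {q : FormalMultilinearSeries 𝕜 E F} {z w : E} {r : ENNReal}
    (hf : HasFPowerSeriesOnBall f q z r) (hw : w ∈ Metric.eball (0 : E) r)
    (h : ∀ᶠ s in 𝓝 (0 : 𝕜), f (z + s • w) = 0) : f (z + w) = 0 := by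
  let u : 𝕜 →L[𝕜] E := ContinuousLinearMap.toSpanSingleton 𝕜 w
  have hg : HasFPowerSeriesOnBall (fun x => f (z + x)) q (u 0) r :=
    ⟨hf.r_le, hf.r_pos, fun hy => by simpa using hf.hasSum hy⟩
  have hq : q.compContinuousLinearMap u = 0 :=
    hg.compContinuousLinearMap.hasFPowerSeriesAt.eq_zero_of_eventually
      (by filter_upwards [h] with s hs using by simpa [u] using hs)
  have hterm (n : ℕ) : (q n fun _ => w) = 0 := by
    have hn : q.compContinuousLinearMap u n (fun _ => 1) = 0 := by rw [hq]; rfl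
    rw [FormalMultilinearSeries.compContinuousLinearMap_apply] at hn
    simpa [u, Function.comp_def] using hn
  have hs := hf.hasSum hw
  simp only [hterm] at hs
  exact hs.unique hasSum_zero

/-- A measurable set that avoids a point `c` and is relatively discrete on every line through `c`
is null for every additive Haar measure. -/
theorem measure_eq_zero_of_discrete_on_lines
    {𝕜 E : Type*} [NontriviallyNormedField 𝕜] [LocallyCompactSpace 𝕜] [SecondCountableTopology 𝕜]
    [NormedAddCommGroup E] [NormedSpace 𝕜 E] [LocallyCompactSpace E] [SecondCountableTopology E]
    [MeasurableSpace E] [BorelSpace E] (μ : Measure E) [μ.IsAddHaarMeasure]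
    {N : Set E} (hN : MeasurableSet N) {c : E} (hc : c ∉ N)
    (h : ∀ z ∈ N, ∀ᶠ s in 𝓝[≠] (0 : 𝕜), z + s • (c - z) ∉ N) : μ N = 0 := by
  let _ : MeasurableSpace 𝕜 := borel 𝕜
  have : BorelSpace 𝕜 := ⟨rfl⟩
  let ν : Measure 𝕜 := Measure.addHaar
  have hA : MeasurableSet {a : 𝕜 × E | c + a.1 • a.2 ∈ N} :=
    (by fun_prop : Continuous fun a : 𝕜 × E => c + a.1 • a.2).measurable hN
  have hline (v : E) : ν {t : 𝕜 | c + t • v ∈ N} = 0 := by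
    refine measure_null_of_locally_null _ fun t₀ ht₀ => ⟨{t₀}, ?_, measure_singleton t₀⟩
    have ht : t₀ ≠ 0 := by
      rintro rfl
      exact hc (by simpa using ht₀)
    have hlim : Tendsto (fun t : 𝕜 => 1 - t / t₀) (𝓝[≠] t₀) (𝓝[≠] 0) := by
      refine tendsto_nhdsWithin_iff.2 ⟨?_, ?_⟩
      · have : ContinuousAt (fun t : 𝕜 => 1 - t / t₀) t₀ := by fun_prop
        simpa [ContinuousAt, ht] using this.tendsto.mono_left nhdsWithin_le_nhds
      · filter_upwards [self_mem_nhdsWithin] with t htt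
        exact fun h1 => htt ((div_eq_one_iff_eq ht).1 (sub_eq_zero.1 h1).symm)
    have hev := hlim.eventually (h _ ht₀)
    rw [eventually_nhdsWithin_iff] at hev
    rw [mem_nhdsWithin_iff_eventually]
    filter_upwards [hev] with t htt htN
    by_contra hne
    refine htt hne ?_
    have hz : c + t₀ • v + (1 - t / t₀) • (c - (c + t₀ • v)) = c + t • v := by
      rw [sub_add_cancel_left, smul_neg, smul_smul, sub_mul, div_mul_cancel₀ _ ht, one_mul,
        sub_smul]
      abel
    rwa [hz]
  have hprod : (ν.prod μ) {a : 𝕜 × E | c + a.1 • a.2 ∈ N} = 0 := by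
    rw [Measure.prod_apply_symm hA]
    simp only [Set.preimage_ofPred_eq, hline, lintegral_zero]
  obtain ⟨t, ht, ht0⟩ := ((Measure.measure_ae_null_of_prod_null hprod).and
    (compl_mem_ae_iff.2 (measure_singleton (0 : 𝕜)) : ∀ᵐ t ∂ν, t ∈ ({0} : Set 𝕜)ᶜ)).exists
  let L : E ≃L[𝕜] E := ContinuousLinearEquiv.smulLeft (Units.mk0 t ht0)
  have hmap : (μ.map L) ((fun x => c + x) ⁻¹' N) = 0 := by
    rw [Measure.map_apply L.continuous.measurable (measurable_const_add c hN)]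
    exact ht
  have := Measure.absolutelyContinuous_isAddHaarMeasure μ (μ.map L) hmap
  rwa [measure_preimage_add] at this

/-- Near a point of analyticity, the zero set of an analytic map is either a neighbourhood of
the point or null. -/
theorem AnalyticAt.eventually_eq_zero_or_measure_zero_set_eq_zero
    {𝕜 E F : Type*} [NontriviallyNormedField 𝕜] [LocallyCompactSpace 𝕜] [SecondCountableTopology 𝕜]
    [NormedAddCommGroup E] [NormedSpace 𝕜 E] [LocallyCompactSpace E] [SecondCountableTopology E]
    [NormedAddCommGroup F] [NormedSpace 𝕜 F] [CompleteSpace F]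
    [MeasurableSpace E] [BorelSpace E] (μ : Measure E) [μ.IsAddHaarMeasure]
    {g : E → F} {x : E} (hg : AnalyticAt 𝕜 g x) :
    (∀ᶠ z in 𝓝 x, g z = 0) ∨ ∃ V ∈ 𝓝 x, μ (V ∩ {z | g z = 0}) = 0 := by
  obtain ⟨q, R, hR⟩ := hg
  obtain ⟨ε, hε, hεR⟩ := ENNReal.lt_iff_exists_nnreal_btwn.1 hR.r_pos
  have hq := hR.mono hε hεR.le
  have hε0 : (0 : ℝ) < ε := by exact_mod_cast hε
  by_cases hzero : ∀ᶠ z in 𝓝 x, g z = 0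
  · exact Or.inl hzero
  have hball : Metric.ball x (ε / 4) ∈ 𝓝 x := Metric.ball_mem_nhds x (by positivity)
  refine Or.inr ⟨Metric.ball x (ε / 4), hball, ?_⟩
  obtain ⟨c, hc, hgc⟩ : ∃ c ∈ Metric.ball x (ε / 4), g c ≠ 0 := by
    by_contra! hcon
    exact hzero (mem_of_superset hball hcon)
  have hcont : ContinuousOn g (Metric.ball x (ε / 4)) := by
    refine hq.continuousOn.mono fun z hz => ?_
    rw [Metric.eball_coe]
    exact Metric.ball_subset_ball (by linarith) hz
  have hmeas : MeasurableSet (Metric.ball x (ε / 4) ∩ {z | g z = 0}) := by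
    obtain ⟨C, hC, hCeq⟩ := continuousOn_iff_isClosed.1 hcont {0} isClosed_singleton
    have : Metric.ball x (ε / 4) ∩ {z | g z = 0} = C ∩ Metric.ball x (ε / 4) := by
      rw [← hCeq, Set.inter_comm]
      rfl
    rw [this]
    exact hC.measurableSet.inter measurableSet_ball
  refine measure_eq_zero_of_discrete_on_lines (𝕜 := 𝕜) μ hmeas (c := c) (fun h => hgc h.2) ?_
  rintro z ⟨hzx, hgz⟩
  rw [mem_ball_iff_norm] at hzx hc
  have hzε : ((‖z - x‖₊ : NNReal) : ENNReal) < ε := by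
    rw [ENNReal.coe_lt_coe, ← NNReal.coe_lt_coe, coe_nnnorm]
    linarith
  have hz := hq.changeOrigin hzε
  rw [add_sub_cancel] at hz
  have hcz : c - z ∈ Metric.eball (0 : E) (ε - (‖z - x‖₊ : NNReal)) := by
    rw [← ENNReal.coe_sub, Metric.eball_coe, mem_ball_zero_iff,
      NNReal.coe_sub (ENNReal.coe_lt_coe.1 hzε).le, coe_nnnorm]
    have : ‖c - z‖ ≤ ‖c - x‖ + ‖z - x‖ := by
      simpa using norm_sub_le (c - x) (z - x)
    linarith
  have han : AnalyticAt 𝕜 (fun s : 𝕜 => g (z + s • (c - z))) 0 := by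
    refine AnalyticAt.fun_comp (g := g) ?_ (by fun_prop)
    simpa using hz.analyticAt
  rcases han.eventually_eq_zero_or_eventually_ne_zero with h0 | h0
  · refine absurd ?_ hgc
    simpa using hz.eq_zero_of_eventually_eq_zero_on_line hcz h0
  · filter_upwards [h0] with s hs hsN using hs hsN.2

/-- Let `f : ℚ_p^m → ℚ_p^n` be analytic on an open set `U` and `y ∈ ℚ_p^n`.
Then the fibre `S = {x ∈ U | f x = y}` either has nonempty interior or is null for
(any) additive Haar measure on `ℚ_p^m`. -/
theorem analytic_fibre_interior_or_null
    {p : ℕ} [Fact p.Prime] {m n : ℕ} (hm : 1 ≤ m) (hn : 1 ≤ n)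
    [MeasurableSpace (Fin m → ℚ_[p])] [BorelSpace (Fin m → ℚ_[p])]
    (μ : Measure (Fin m → ℚ_[p])) [μ.IsAddHaarMeasure]
    (U : Set (Fin m → ℚ_[p])) (hU : IsOpen U)
    (f : (Fin m → ℚ_[p]) → (Fin n → ℚ_[p]))
    (hf : ∀ x ∈ U, AnalyticAt ℚ_[p] f x)
    (y : Fin n → ℚ_[p]) :
    (interior {x ∈ U | f x = y}).Nonempty ∨ μ {x ∈ U | f x = y} = 0 := by
  refine or_iff_not_imp_left.2 fun hint => measure_null_of_locally_null _ ?_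
  rintro x ⟨hxU, hxy⟩
  have hg : AnalyticAt ℚ_[p] (fun z => f z - y) x := (hf x hxU).sub analyticAt_const
  rcases hg.eventually_eq_zero_or_measure_zero_set_eq_zero μ with h0 | ⟨V, hV, hV0⟩
  · refine absurd ⟨x, mem_interior_iff_mem_nhds.2 ?_⟩ hint
    filter_upwards [h0, hU.mem_nhds hxU] with z hz hzU using ⟨hzU, sub_eq_zero.1 hz⟩
  · refine ⟨V ∩ {z | f z - y = 0}, ?_, hV0⟩
    filter_upwards [mem_nhdsWithin_of_mem_nhds hV, self_mem_nhdsWithin] with z hzV hz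
      using ⟨hzV, sub_eq_zero.2 hz.2⟩
end

section
/- Let A be a finitely generated (as a ring) integral domain. Then there exists a prime number p such that either (i) there exist a field K which is a finite-dimensional field extension of ℚ_p and an injective ring homomorphism from A into the integral closure of ℤ_p in K, or (ii) A has characteristic p and there exist a field K which is a finite-dimensional field extension of the Laurent series field 𝔽_p((T)) and an injective ring homomorphism from A into the integral closure of 𝔽_p⟦T⟧ in K. -/
open Polynomial in
/-- Let `A` be a domain generated as a ring by a finite set `S` and algebraic over `B`, and let
`φ : B →+* R` be injective. If every element of `S` is a root of a polynomial over `B` whose leading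
coefficient becomes a unit in `R`, then `A` embeds into the integral closure of `R` in a finite
extension of the fraction field `F` of `R`. -/
theorem exists_injective_to_integralClosure {A B : Type*} {R F : Type} [CommRing A] [IsDomain A]
    [CommRing B] [CommRing R] [Field F] [Algebra R F] [FaithfulSMul R F] [Algebra B A]
    [FaithfulSMul B A] [Algebra.IsAlgebraic B A] (φ : B →+* R) (hφ : Function.Injective φ)
    (S : Finset A) (hS : Algebra.adjoin ℤ (S : Set A) = ⊤)
    (hroot : ∀ a ∈ S, ∃ P : B[X], aeval a P = 0 ∧ IsUnit (φ P.leadingCoeff)) :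
    ∃ (K : Type) (_ : Field K) (_ : Algebra F K) (_ : FiniteDimensional F K) (_ : Algebra R K)
      (_ : IsScalarTower R F K), ∃ f : A →+* integralClosure R K, Function.Injective f := by
  let Ω := AlgebraicClosure F
  have hRΩ : Function.Injective (algebraMap R Ω) := by
    rw [IsScalarTower.algebraMap_eq R F Ω]
    exact (algebraMap F Ω).injective.comp (FaithfulSMul.algebraMap_injective R F)
  let : Algebra B Ω := ((algebraMap R Ω).comp φ).toAlgebra
  have hBΩ : Function.Injective (algebraMap B Ω) := hRΩ.comp hφ
  have : IsDomain B := (FaithfulSMul.algebraMap_injective B A).isDomain _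
  have : FaithfulSMul B Ω := (faithfulSMul_iff_algebraMap_injective _ _).mpr hBΩ
  let f : A →ₐ[B] Ω := IsAlgClosed.lift
  have hf : Function.Injective f := by
    rw [injective_iff_map_eq_zero]
    intro a ha
    by_contra h0
    obtain ⟨b, hb, hab⟩ := (Algebra.IsAlgebraic.isAlgebraic (R := B) a).exists_nonzero_dvd
      (mem_nonZeroDivisors_of_ne_zero h0)
    obtain ⟨c, hc⟩ := hab
    apply hb
    apply hBΩ
    rw [map_zero, ← f.commutes, hc, map_mul, ha, zero_mul]
  let K := IntermediateField.adjoin F (f '' (S : Set A))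
  have hfin : FiniteDimensional F K :=
    IntermediateField.finiteDimensional_adjoin fun x _ =>
      (Algebra.IsAlgebraic.isAlgebraic (R := F) x).isIntegral
  have hint : ∀ a ∈ S, IsIntegral R (f a) := by
    intro a ha
    obtain ⟨P, hP, u, hu⟩ := hroot a ha
    have h1 : IsIntegral R (algebraMap R Ω (φ P.leadingCoeff) * f a) := by
      have := (algebraMap R Ω).isIntegralElem_leadingCoeff_mul (P.map φ) (f a) <| by
        rw [eval₂_map]
        change aeval (f a) P = 0
        rw [aeval_algHom_apply, hP, map_zero]
      rwa [leadingCoeff_map_of_injective hφ] at this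
    have h2 := h1.smul (↑u⁻¹ : R)
    rwa [Algebra.smul_def, ← mul_assoc, ← map_mul, ← hu, Units.inv_mul, map_one, one_mul] at h2
  have hall : ∀ a : A, f a ∈ K ∧ IsIntegral R (f a) := by
    intro a
    have ha : a ∈ Algebra.adjoin ℤ (S : Set A) := hS ▸ Algebra.mem_top
    induction ha using Algebra.adjoin_induction with
    | mem x hx =>
      exact ⟨IntermediateField.subset_adjoin F _ (Set.mem_image_of_mem f hx), hint x hx⟩
    | algebraMap n =>
      have hn : f (algebraMap ℤ A n) = n := by simp
      rw [hn]
      refine ⟨intCast_mem K n, ?_⟩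
      simpa using isIntegral_algebraMap (R := R) (A := Ω) (x := (n : R))
    | add x y _ _ hx hy =>
      rw [map_add]
      exact ⟨add_mem hx.1 hy.1, hx.2.add hy.2⟩
    | mul x y _ _ hx hy =>
      rw [map_mul]
      exact ⟨mul_mem hx.1 hy.1, hx.2.mul hy.2⟩
  let fK : A →+* K := f.toRingHom.codRestrict K fun a => (hall a).1
  have : IsScalarTower R K Ω := IsScalarTower.of_algebraMap_eq fun _ => rfl
  have hfK : ∀ a, fK a ∈ integralClosure R K := fun a =>
    (isIntegral_algHom_iff (IsScalarTower.toAlgHom R K Ω) Subtype.val_injective).mp (hall a).2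
  refine ⟨K, inferInstance, inferInstance, hfin, inferInstance, inferInstance,
    fK.codRestrict (integralClosure R K) hfK, fun a b hab => hf ?_⟩
  exact congrArg (fun z : integralClosure R K => ((z : K) : Ω)) hab

/-- An uncountable domain contains arbitrarily large finite families which are
algebraically independent over a given countable subring. -/
theorem exists_algebraicIndependent_of_uncountable (k R : Type) [CommRing k] [CommRing R]
    [IsDomain R] [Algebra k R] [FaithfulSMul k R] [Countable k] [Uncountable R]
    (ι : Type*) [Finite ι] : ∃ t : ι → R, AlgebraicIndependent k t := by
  have : Nontrivial k := (algebraMap k R).domain_nontrivial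
  obtain ⟨s, hs⟩ := exists_isTranscendenceBasis k R
  have hinf : Infinite s := by
    by_contra hfin
    rw [not_infinite_iff_finite] at hfin
    have halg : Algebra.IsAlgebraic (Algebra.adjoin k (Set.range ((↑) : s → R))) R :=
      hs.isAlgebraic
    have hc : Countable (Algebra.adjoin k (Set.range ((↑) : s → R))) :=
      have : Countable (MvPolynomial s k) := by
        rw [← Cardinal.mk_le_aleph0_iff]
        exact MvPolynomial.cardinalMk_le_max.trans (by simp [Cardinal.mk_le_aleph0])
      hs.1.aevalEquiv.symm.injective.countable
    have hle := Algebra.IsAlgebraic.cardinalMk_le_max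
      (Algebra.adjoin k (Set.range ((↑) : s → R))) R
    rw [max_eq_right (Cardinal.mk_le_aleph0_iff.mpr hc), Cardinal.mk_le_aleph0_iff] at hle
    exact not_countable_iff.mpr ‹Uncountable R› hle
  obtain ⟨n, ⟨e⟩⟩ := Finite.exists_equiv_fin ι
  obtain ⟨g⟩ : Nonempty (Fin n ↪ s) := ⟨(Fin.valEmbedding).trans (Infinite.natEmbedding s)⟩
  exact ⟨_, hs.1.comp (g ∘ e) (g.injective.comp e.injective)⟩

theorem PadicInt.uncountable (p : ℕ) [Fact p.Prime] : Uncountable ℤ_[p] := by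
  rw [← not_countable_iff]
  intro h
  have hQ : Countable ℚ_[p] :=
    (IsLocalization.mk'_surjective (nonZeroDivisors ℤ_[p]) (S := ℚ_[p])).countable
  have := continuum_le_cardinal_of_nontriviallyNormedField ℚ_[p]
  exact absurd (this.trans (Cardinal.mk_le_aleph0_iff.mpr hQ))
    (not_le.mpr Cardinal.aleph0_lt_continuum)

theorem PowerSeries.uncountable (k : Type*) [Semiring k] [Nontrivial k] :
    Uncountable (PowerSeries k) := by
  classical
  have hinj : Function.Injective
      (fun s : Set ℕ => PowerSeries.mk fun n => if n ∈ s then (1 : k) else 0) := by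
    intro s t hst
    ext n
    have := congrArg (PowerSeries.coeff n) hst
    by_cases h1 : n ∈ s <;> by_cases h2 : n ∈ t <;> simp [h1, h2] at this ⊢
  rw [← not_countable_iff]
  intro h
  obtain ⟨f, hf⟩ := hinj.countable.exists_injective_nat
  exact Function.cantor_injective f hf

theorem MvPolynomial.exists_eval_ne_zero {σ k : Type*} [CommRing k] [IsDomain k] [Infinite k]
    {g : MvPolynomial σ k} (hg : g ≠ 0) : ∃ c : σ → k, eval c g ≠ 0 := by
  by_contra! h
  exact hg (MvPolynomial.funext fun c => by simpa using h c)

/-- A nonzero integral polynomial takes a unit value at some algebraically independent point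
over `ℤ_[p]`, for a suitable prime `p`. -/
theorem exists_algebraicIndependent_isUnit_aeval {ι : Type*} [Finite ι] {g : MvPolynomial ι ℤ}
    (hg : g ≠ 0) : ∃ (p : ℕ) (_ : Fact p.Prime) (t : ι → ℤ_[p]),
      AlgebraicIndependent ℤ t ∧ IsUnit (MvPolynomial.aeval t g) := by
  obtain ⟨c, hc⟩ := MvPolynomial.exists_eval_ne_zero hg
  obtain ⟨p, hlt, hp⟩ := Nat.exists_infinite_primes ((MvPolynomial.eval c g).natAbs + 1)
  have : Fact p.Prime := ⟨hp⟩
  have := PadicInt.uncountable p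
  obtain ⟨s, hs⟩ := exists_algebraicIndependent_of_uncountable ℤ ℤ_[p] ι
  have ht := hs.polynomial_aeval_of_transcendental
    (f := fun i => Polynomial.C (p : ℤ) * Polynomial.X + Polynomial.C (c i)) fun i => by
      have hp0 : (p : ℤ) ≠ 0 := by exact_mod_cast hp.ne_zero
      refine Polynomial.transcendental _ ?_ ?_
      · rw [Polynomial.natDegree_linear hp0]
        simp
      · rw [Polynomial.leadingCoeff_linear hp0]
        exact mem_nonZeroDivisors_of_ne_zero hp0
  refine ⟨p, ‹_›, _, ht, ?_⟩
  by_contra hu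
  have hmem : MvPolynomial.aeval (fun i => Polynomial.aeval (s i)
      (Polynomial.C (p : ℤ) * Polynomial.X + Polynomial.C (c i))) g ∈
        RingHom.ker (PadicInt.toZMod (p := p)) := by
    rw [PadicInt.ker_toZMod]
    exact (IsLocalRing.mem_maximalIdeal _).mpr hu
  rw [RingHom.mem_ker, MvPolynomial.map_aeval] at hmem
  have hcomp : MvPolynomial.eval₂Hom ((PadicInt.toZMod (p := p)).comp (algebraMap ℤ ℤ_[p]))
      (fun i => PadicInt.toZMod (Polynomial.aeval (s i)
        (Polynomial.C (p : ℤ) * Polynomial.X + Polynomial.C (c i)))) g =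
      ((MvPolynomial.eval c g : ℤ) : ZMod p) := by
    rw [← eq_intCast (Int.castRingHom (ZMod p)), MvPolynomial.eval, ← RingHom.comp_apply]
    congr 1
    ext i
    · simp
    · simp
  rw [hcomp, ZMod.intCast_zmod_eq_zero_iff_dvd] at hmem
  have := Nat.le_of_dvd (Int.natAbs_pos.mpr hc) (Int.natCast_dvd.mp hmem)
  omega

open Polynomial in
/-- A finitely generated domain of characteristic zero embeds into the ring of integers of a finite
extension of `ℚ_[p]` for some prime `p`. -/
theorem exists_embedding_of_charZero (A : Type*) [CommRing A] [IsDomain A] [CharZero A]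
    (S : Finset A) (hS : Algebra.adjoin ℤ (S : Set A) = ⊤) :
    ∃ (p : ℕ) (_ : Fact p.Prime), ∃ (K : Type) (_ : Field K) (_ : Algebra ℚ_[p] K)
      (_ : FiniteDimensional ℚ_[p] K) (_ : Algebra ℤ_[p] K) (_ : IsScalarTower ℤ_[p] ℚ_[p] K),
      ∃ f : A →+* integralClosure ℤ_[p] K, Function.Injective f := by
  have : FaithfulSMul ℤ A :=
    (faithfulSMul_iff_algebraMap_injective ℤ A).mpr (RingHom.injective_int _)
  have : Algebra.IsAlgebraic (Algebra.adjoin ℤ (S : Set A)) A :=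
    ⟨fun a => isAlgebraic_algebraMap (⟨a, hS ▸ Algebra.mem_top⟩ : Algebra.adjoin ℤ (S : Set A))⟩
  obtain ⟨u, huS, hu⟩ := exists_isTranscendenceBasis_subset (R := ℤ) (S : Set A)
  have : Finite u := S.finite_toSet.subset huS
  let B := Algebra.adjoin ℤ (Set.range ((↑) : u → A))
  have : Algebra.IsAlgebraic B A := hu.isAlgebraic
  let e : MvPolynomial u ℤ ≃ₐ[ℤ] B := hu.1.aevalEquiv
  choose P hP0 hP using fun a : A => Algebra.IsAlgebraic.isAlgebraic (R := B) a
  have hg : ∏ a ∈ S, e.symm (P a).leadingCoeff ≠ 0 :=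
    Finset.prod_ne_zero_iff.mpr fun a _ => by simpa using hP0 a
  obtain ⟨p, hp, t, ht, hunit⟩ := exists_algebraicIndependent_isUnit_aeval hg
  let φ : B →+* ℤ_[p] := ((MvPolynomial.aeval t).comp e.symm.toAlgHom : B →ₐ[ℤ] ℤ_[p]).toRingHom
  have hφ : Function.Injective φ := Function.Injective.comp (g := MvPolynomial.aeval t) ht
    e.symm.injective
  refine ⟨p, hp, exists_injective_to_integralClosure φ hφ S hS fun a ha => ⟨P a, hP a, ?_⟩⟩
  rw [map_prod] at hunit
  exact (IsUnit.prod_iff.mp hunit) a ha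

/-- A finitely generated domain of characteristic `p` embeds into the ring of integers of a finite
extension of `𝔽_p((T))`. -/
theorem exists_embedding_of_charP (A : Type*) [CommRing A] [IsDomain A] (p : ℕ) [Fact p.Prime]
    [CharP A p] (S : Finset A) (hS : Algebra.adjoin ℤ (S : Set A) = ⊤) :
    ∃ (K : Type) (_ : Field K) (_ : Algebra (LaurentSeries (ZMod p)) K)
      (_ : FiniteDimensional (LaurentSeries (ZMod p)) K) (_ : Algebra (PowerSeries (ZMod p)) K)
      (_ : IsScalarTower (PowerSeries (ZMod p)) (LaurentSeries (ZMod p)) K),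
      ∃ f : A →+* integralClosure (PowerSeries (ZMod p)) K, Function.Injective f := by
  let : Algebra (ZMod p) A := ZMod.algebra A p
  have : Algebra.FiniteType ℤ A := ⟨⟨S, hS⟩⟩
  have : Algebra.FiniteType (ZMod p) A :=
    Algebra.FiniteType.of_restrictScalars_finiteType ℤ (ZMod p) A
  obtain ⟨n, g, hg, hint⟩ := exists_integral_inj_algHom_of_fg (ZMod p) A
  let : Algebra (MvPolynomial (Fin n) (ZMod p)) A := g.toRingHom.toAlgebra
  have : FaithfulSMul (MvPolynomial (Fin n) (ZMod p)) A :=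
    (faithfulSMul_iff_algebraMap_injective _ _).mpr hg
  have : Algebra.IsIntegral (MvPolynomial (Fin n) (ZMod p)) A := ⟨hint⟩
  have := PowerSeries.uncountable (ZMod p)
  obtain ⟨t, ht⟩ := exists_algebraicIndependent_of_uncountable (ZMod p) (PowerSeries (ZMod p))
    (Fin n)
  let φ : MvPolynomial (Fin n) (ZMod p) →+* PowerSeries (ZMod p) :=
    (MvPolynomial.aeval (R := ZMod p) t).toRingHom
  refine exists_injective_to_integralClosure φ ht S hS fun a _ => ?_
  obtain ⟨P, hP, h0⟩ := hint a
  exact ⟨P, h0, by simp [hP.leadingCoeff]⟩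


/-- A finitely generated integral domain embeds into the ring of
integers of a local field: either into the integral closure of `ℤ_p` in a finite extension
`K` of `ℚ_p`, or (if `A` has characteristic `p`) into the integral closure of `𝔽_p⟦T⟧` in a
finite extension `K` of the Laurent series field `𝔽_p((T))`. -/
theorem finitely_generated_domain_embeds_in_ring_of_integers
    (A : Type*) [CommRing A] [IsDomain A] (hA : Algebra.FiniteType ℤ A) :
    ∃ (p : ℕ) (_ : Fact p.Prime),
      (∃ (K : Type) (_ : Field K) (_ : Algebra ℚ_[p] K)
          (_ : FiniteDimensional ℚ_[p] K) (_ : Algebra ℤ_[p] K)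
          (_ : IsScalarTower ℤ_[p] ℚ_[p] K),
          ∃ f : A →+* integralClosure ℤ_[p] K, Function.Injective f) ∨
      (CharP A p ∧
        ∃ (K : Type) (_ : Field K) (_ : Algebra (LaurentSeries (ZMod p)) K)
          (_ : FiniteDimensional (LaurentSeries (ZMod p)) K)
          (_ : Algebra (PowerSeries (ZMod p)) K)
          (_ : IsScalarTower (PowerSeries (ZMod p)) (LaurentSeries (ZMod p)) K),
          ∃ f : A →+* integralClosure (PowerSeries (ZMod p)) K, Function.Injective f) := by
  obtain ⟨S, hS⟩ := hA.out
  obtain ⟨q, hq⟩ := CharP.exists A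
  obtain hprime | rfl := CharP.char_is_prime_or_zero A q
  · have : Fact q.Prime := ⟨hprime⟩
    exact ⟨q, ‹_›, Or.inr ⟨hq, exists_embedding_of_charP A q S hS⟩⟩
  · have := CharP.charP_to_charZero A
    obtain ⟨p, hp, h⟩ := exists_embedding_of_charZero A S hS
    exact ⟨p, hp, Or.inl h⟩
end
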